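/- arXiv:2102.02487 — 2 statements merged into one kernel-verified Lean document; each statement's English description precedes it below -/
import Mathlib

section
/- For every real C > 0 there exists n₀ such that for every integer n > n₀, every graph G on n vertices satisfies s*(G) ≤ n²/C; that is, G admits a vertex sum-distinguishing labeling whose labels are all at most ⌈n²/C⌉. -/
open Classical in
/-- The closed neighborhood of a vertex `v` in a graph `G`, as a `Finset`. -/
noncomputable def closedNbr {V : Type*} [Fintype V] (G : SimpleGraph V) (v : V) : Finset V :=
  Finset.univ.filter (fun u => u = v ∨ G.Adj u v)

/-- A labeling of the vertices of a graph `G` by positive integers is vertex sum-distinguishing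
if any two vertices with distinct closed neighborhoods receive distinct sums of labels over
their closed neighborhoods. -/
def VertexSumDistinguishing {V : Type*} [Fintype V] (G : SimpleGraph V) (f : V → ℕ) : Prop :=
  (∀ v, 1 ≤ f v) ∧ ∀ u v : V, closedNbr G u ≠ closedNbr G v →
    ∑ x ∈ closedNbr G u, f x ≠ ∑ x ∈ closedNbr G v, f x

section CollisionCounting

open Finset

variable {V α M : Type*} [DecidableEq V]

/-- The labeling `x ↦ w (g x)` has equal sums over the two parts of `q`. -/
def Collides [AddCommMonoid M] (w : α → M) (q : Finset V × Finset V) (g : V → α) : Prop :=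
  ∑ x ∈ q.1, w (g x) = ∑ x ∈ q.2, w (g x)

lemma sum_comp_update_of_mem [AddCommMonoid M] (w : α → M) {s : Finset V} {a : V} (ha : a ∈ s)
    (g : V → α) (t : α) :
    ∑ x ∈ s, w (Function.update g a t x) = w t + ∑ x ∈ s.erase a, w (g x) := by
  rw [← Finset.add_sum_erase _ _ ha, Function.update_self]
  congr 1
  refine Finset.sum_congr rfl fun x hx => ?_
  rw [Function.update_of_ne (Finset.ne_of_mem_erase hx)]

lemma sum_comp_update_of_notMem [AddCommMonoid M] (w : α → M) {s : Finset V} {a : V} (ha : a ∉ s)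
    (g : V → α) (t : α) :
    ∑ x ∈ s, w (Function.update g a t x) = ∑ x ∈ s, w (g x) := by
  refine Finset.sum_congr rfl fun x hx => ?_
  rw [Function.update_of_ne (ne_of_mem_of_not_mem hx ha)]

lemma Collides.update_iff [AddCommMonoid M] {w : α → M} {q : Finset V × Finset V} {a : V}
    (ha : a ∉ q.1 ∪ q.2) (g : V → α) (t : α) :
    Collides w q (Function.update g a t) ↔ Collides w q g := by
  rw [mem_union, not_or] at ha
  rw [Collides, Collides, sum_comp_update_of_notMem w ha.1, sum_comp_update_of_notMem w ha.2]

lemma Collides.eq_of_update [AddCancelCommMonoid M] {w : α → M} (hw : Function.Injective w)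
    {q : Finset V × Finset V} (hq : Disjoint q.1 q.2) {a : V} (ha : a ∈ q.1 ∪ q.2)
    {g : V → α} {t : α} (h₁ : Collides w q g) (h₂ : Collides w q (Function.update g a t)) :
    g a = t := by
  apply hw
  rw [Collides] at h₁ h₂
  rcases mem_union.1 ha with ha | ha
  · rw [sum_comp_update_of_mem w ha,
      sum_comp_update_of_notMem w (Finset.disjoint_left.1 hq ha), ← h₁,
      ← Finset.add_sum_erase _ _ ha] at h₂
    exact (add_right_cancel h₂).symm
  · rw [sum_comp_update_of_mem w ha,
      sum_comp_update_of_notMem w (Finset.disjoint_right.1 hq ha), h₁,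
      ← Finset.add_sum_erase _ _ ha] at h₂
    exact add_right_cancel h₂

variable [Fintype α]

open Classical in
/-- A predicate that holds for at most one value of the coordinate `a` has density at most
`1 / card α` in any set closed under changes of that coordinate. -/
lemma card_filter_mul_card_le_of_update (A : Finset (V → α)) (a : V)
    (hA : ∀ g ∈ A, ∀ t, Function.update g a t ∈ A) (P : (V → α) → Prop)
    (hP : ∀ g t, P g → P (Function.update g a t) → g a = t) :
    #(A.filter P) * Fintype.card α ≤ #A := by
  rw [← Finset.card_univ, ← Finset.card_product]
  refine Finset.card_le_card_of_injOn (fun p => Function.update p.1 a p.2) ?_ ?_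
  · rintro ⟨g, t⟩ h
    simp only [coe_product, Set.mem_prod, mem_coe, mem_filter] at h
    exact hA g h.1.1 t
  · rintro ⟨g, t⟩ h ⟨g', t'⟩ h' e
    simp only [coe_product, Set.mem_prod, mem_coe, mem_filter] at h h' e
    have ht : t = t' := by simpa using congrFun e a
    have hg : Function.update g a (g' a) = g' := by
      have := congrArg (fun k => Function.update k a (g' a)) e
      simpa using this
    have hga : g a = g' a := hP g _ h.1.2 (hg.symm ▸ h'.1.2)
    rw [← hga, Function.update_eq_self] at hg
    rw [hg, ht]

variable [Fintype V]

open Classical in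
/-- Each constraint with a coordinate in its support is violated with probability at most
`1 / card α`. -/
lemma card_collides_mul_card_le [AddCancelCommMonoid M] {w : α → M} (hw : Function.Injective w)
    {q : Finset V × Finset V} (hq : Disjoint q.1 q.2) (hne : (q.1 ∪ q.2).Nonempty) :
    #{g : V → α | Collides w q g} * Fintype.card α ≤ Fintype.card (V → α) := by
  obtain ⟨a, ha⟩ := hne
  exact card_filter_mul_card_le_of_update univ a (fun _ _ _ => mem_univ _) _
    fun g t h₁ h₂ => h₁.eq_of_update hw hq ha h₂

lemma four_rpow_neg_le_one_sub {x : ℝ} (h₀ : 0 ≤ x) (h₁ : x ≤ 1 / 2) :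
    (4 : ℝ) ^ (-x) ≤ 1 - x := by
  have h := rpow_one_add_le_one_add_mul_self (s := (-(1 / 2) : ℝ)) (p := 2 * x)
    (by norm_num) (by linarith) (by linarith)
  calc (4 : ℝ) ^ (-x) = (1 + -(1 / 2) : ℝ) ^ (2 * x) := by
        rw [Real.rpow_mul (by norm_num), Real.rpow_neg (by norm_num),
          ← Real.inv_rpow (by norm_num)]
        norm_num
    _ ≤ 1 + 2 * x * -(1 / 2) := h
    _ = 1 - x := by ring

open Classical in
/-- If every constraint involves a coordinate lying in at most half of `card α` constraints, then
a positive proportion of all assignments satisfies all constraints simultaneously. -/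
lemma le_card_forall_not_collides [AddCancelCommMonoid M] {w : α → M} (hw : Function.Injective w)
    [Nonempty α] (Q : Finset (Finset V × Finset V)) (hd : ∀ q ∈ Q, Disjoint q.1 q.2)
    (hlight : ∀ q ∈ Q, ∃ a ∈ q.1 ∪ q.2, 2 * #{r ∈ Q | a ∈ r.1 ∪ r.2} ≤ Fintype.card α) :
    (Fintype.card (V → α) : ℝ) * 4 ^ (-(#Q : ℝ) / Fintype.card α) ≤
      #{g : V → α | ∀ q ∈ Q, ¬ Collides w q g} := by
  induction Q using Finset.strongInduction with
  | H Q ih =>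
  rcases Q.eq_empty_or_nonempty with rfl | ⟨q₀, hq₀⟩
  · simp
  obtain ⟨a, ha, hcard⟩ := hlight q₀ hq₀
  set N := Fintype.card α
  have hN : (0 : ℝ) < N := by exact_mod_cast Fintype.card_pos
  set Qa := {r ∈ Q | a ∈ r.1 ∪ r.2} with hQa
  set Q' := {r ∈ Q | ¬ a ∈ r.1 ∪ r.2} with hQ'
  have hsub : Q' ⊆ Q := filter_subset _ _
  have hsum : #Qa + #Q' = #Q := card_filter_add_card_filter_not _
  have hIH := ih Q' (filter_ssubset.2 ⟨q₀, hq₀, fun h => h ha⟩)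
      (fun q hq => hd q (hsub hq)) fun q hq => by
    obtain ⟨b, hb, hb'⟩ := hlight q (hsub hq)
    exact ⟨b, hb, le_trans (by gcongr) hb'⟩
  set G' : Finset (V → α) := {g | ∀ q ∈ Q', ¬ Collides w q g} with hG'
  set G : Finset (V → α) := {g | ∀ q ∈ Q, ¬ Collides w q g} with hG
  have hinv : ∀ g ∈ G', ∀ t, Function.update g a t ∈ G' := by
    intro g hg t
    simp only [hG', mem_filter, mem_univ, true_and] at hg ⊢
    intro q hq
    rw [Collides.update_iff (mem_filter.1 hq).2]
    exact hg q hq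
  have hbad : ∀ q ∈ Qa, #(G'.filter (Collides w q)) * N ≤ #G' := fun q hq =>
    card_filter_mul_card_le_of_update G' a hinv _ fun g t h₁ h₂ =>
      h₁.eq_of_update hw (hd q (mem_filter.1 hq).1) (mem_filter.1 hq).2 h₂
  have hcover : G' ⊆ G ∪ Qa.biUnion fun q => G'.filter (Collides w q) := by
    intro g hg
    by_cases h : ∃ q ∈ Qa, Collides w q g
    · obtain ⟨q, hq, hc⟩ := h
      exact mem_union_right _ (mem_biUnion.2 ⟨q, hq, mem_filter.2 ⟨hg, hc⟩⟩)
    · push Not at h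
      refine mem_union_left _ (mem_filter.2 ⟨mem_univ _, fun q hq => ?_⟩)
      by_cases hqa : a ∈ q.1 ∪ q.2
      · exact h q (mem_filter.2 ⟨hq, hqa⟩)
      · exact (mem_filter.1 hg).2 q (mem_filter.2 ⟨hq, hqa⟩)
  have hcount : (#G' : ℝ) * (1 - #Qa / N) ≤ #G := by
    have h₁ : #G' ≤ #G + ∑ q ∈ Qa, #(G'.filter (Collides w q)) :=
      (card_le_card hcover).trans ((card_union_le _ _).trans (by gcongr; exact card_biUnion_le))
    have h₂ : ((∑ q ∈ Qa, #(G'.filter (Collides w q)) : ℕ) : ℝ) ≤ #Qa * (#G' / N) := by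
      rw [Nat.cast_sum, ← nsmul_eq_mul]
      refine sum_le_card_nsmul _ _ _ fun q hq => ?_
      rw [le_div_iff₀ hN]
      exact_mod_cast hbad q hq
    have h₃ : (#G' : ℝ) ≤ #G + #Qa * (#G' / N) := by
      have : (#G' : ℝ) ≤ #G + ((∑ q ∈ Qa, #(G'.filter (Collides w q)) : ℕ) : ℝ) := by
        exact_mod_cast h₁
      linarith
    have : (#Qa : ℝ) * (#G' / N) = #G' * (#Qa / N) := by ring
    linarith
  have hx : (4 : ℝ) ^ (-(#Qa / N : ℝ)) ≤ 1 - #Qa / N := by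
    refine four_rpow_neg_le_one_sub (by positivity) ?_
    rw [div_le_div_iff₀ hN two_pos]
    have : (2 : ℝ) * #Qa ≤ N := by exact_mod_cast hcard
    linarith
  calc (Fintype.card (V → α) : ℝ) * 4 ^ (-(#Q : ℝ) / N)
      = Fintype.card (V → α) * 4 ^ (-(#Q' : ℝ) / N) * 4 ^ (-(#Qa / N : ℝ)) := by
        rw [mul_assoc, ← Real.rpow_add (by norm_num), ← hsum]
        congr 2
        push_cast
        ring
    _ ≤ #G' * (1 - #Qa / N) := by gcongr
    _ ≤ #G := hcount

end CollisionCounting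

section AntiConcentration

open Finset

lemma two_mul_add_one_mul_centralBinom_sq_le (k : ℕ) :
    (2 * k + 1) * k.centralBinom ^ 2 ≤ 4 ^ (2 * k) := by
  induction k with
  | zero => simp
  | succ k ih =>
    have h := Nat.succ_mul_centralBinom_succ k
    have : (k + 1) ^ 2 * ((2 * (k + 1) + 1) * (k + 1).centralBinom ^ 2) ≤
        (k + 1) ^ 2 * 4 ^ (2 * (k + 1)) := by
      calc (k + 1) ^ 2 * ((2 * (k + 1) + 1) * (k + 1).centralBinom ^ 2)
          = (2 * k + 3) * ((k + 1) * (k + 1).centralBinom) ^ 2 := by ring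
        _ = 4 * ((2 * k + 3) * (2 * k + 1)) * ((2 * k + 1) * k.centralBinom ^ 2) := by
          rw [h]; ring
        _ ≤ 4 * (4 * (k + 1) ^ 2) * 4 ^ (2 * k) := by
          gcongr ?_ * ?_
          nlinarith
        _ = (k + 1) ^ 2 * 4 ^ (2 * (k + 1)) := by ring
    exact Nat.le_of_mul_le_mul_left this (by positivity)

lemma mul_choose_sq_le (d m : ℕ) : d * d.choose m ^ 2 ≤ 4 ^ d := by
  obtain ⟨k, rfl | rfl⟩ := Nat.even_or_odd' d
  · calc 2 * k * (2 * k).choose m ^ 2 ≤ (2 * k + 1) * k.centralBinom ^ 2 := by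
          gcongr
          · omega
          · exact Nat.choose_le_centralBinom m k
      _ ≤ _ := two_mul_add_one_mul_centralBinom_sq_le k
  · have hm : (2 * k + 1).choose m ≤ (2 * k + 1).choose k := by
      have := Nat.choose_le_middle m (2 * k + 1)
      rwa [show (2 * k + 1) / 2 = k by omega] at this
    have hc : 2 * (2 * k + 1).choose k = (k + 1).centralBinom := by
      rw [Nat.centralBinom_eq_two_mul_choose, show 2 * (k + 1) = (2 * k + 1) + 1 by ring,
        Nat.choose_succ_succ', ← Nat.choose_symm_half k]
      omega
    have h := two_mul_add_one_mul_centralBinom_sq_le (k + 1)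
    rw [← hc] at h
    have h2 : (2 * k + 1) * (2 * k + 1).choose m ^ 2 ≤
        (2 * (k + 1) + 1) * (2 * k + 1).choose k ^ 2 := by
      gcongr
      omega
    have h3 : 4 ^ (2 * (k + 1)) = 4 * 4 ^ (2 * k + 1) := by ring
    nlinarith

variable {V : Type*}

/-- The positive integer encoded by its residue and its leading digit: a bijection from
`Fin L × Bool` to the interval `[1, 2 * L]`. -/
def blockLabel (L : ℕ) (p : Fin L × Bool) : ℕ := 1 + p.1 + L * p.2.toNat

lemma blockLabel_injective (L : ℕ) : Function.Injective (blockLabel L) := by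
  rintro ⟨⟨y, hy⟩, b⟩ ⟨⟨y', hy'⟩, b'⟩ h
  simp only [blockLabel] at h
  cases b <;> cases b' <;> simp at h ⊢ <;> omega

lemma blockLabel_le (L : ℕ) (p : Fin L × Bool) : blockLabel L p ≤ 2 * L := by
  have h₁ := p.1.2
  have h₂ := Nat.mul_le_mul_left L (Bool.toNat_le p.2)
  simp only [blockLabel]
  omega

lemma one_le_blockLabel (L : ℕ) (p : Fin L × Bool) : 1 ≤ blockLabel L p := by
  simp only [blockLabel]
  omega

lemma sum_blockLabel (L : ℕ) (g : V → Fin L × Bool) (A : Finset V) :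
    ∑ x ∈ A, blockLabel L (g x) = ∑ x ∈ A, (1 + ((g x).1 : ℕ)) + L * #{x ∈ A | (g x).2} := by
  simp only [blockLabel]
  rw [sum_add_distrib, ← mul_sum, card_filter]
  congr 2
  refine sum_congr rfl fun x _ => ?_
  cases (g x).2 <;> simp

variable [DecidableEq V] [Fintype V]

open Classical in
/-- Littlewood-Offord estimate for the leading digits, the residues being prescribed. -/
lemma card_collides_fiber_sq_le {L : ℕ} (hL : 0 < L) {q : Finset V × Finset V}
    (hq : Disjoint q.1 q.2) (y : V → Fin L) :
    #(q.1 ∪ q.2) * #{g : V → Fin L × Bool | Collides (blockLabel L) q g ∧ Prod.fst ∘ g = y} ^ 2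
      ≤ 4 ^ Fintype.card V := by
  set E : Finset (V → Fin L × Bool) := {g | Collides (blockLabel L) q g ∧ Prod.fst ∘ g = y}
    with hE
  rcases E.eq_empty_or_nonempty with h0 | ⟨g₀, hg₀⟩
  · simp [h0]
  set D := q.1 ∪ q.2
  let φ : (V → Fin L × Bool) → Finset V := fun g =>
    {x ∈ q.1 | (g x).2} ∪ {x ∈ q.2 | ¬ (g x).2}
  have hφcard : ∀ g, #(φ g) = #{x ∈ q.1 | (g x).2} + #{x ∈ q.2 | ¬ (g x).2} := fun g =>
    card_union_of_disjoint (hq.mono (filter_subset _ _) (filter_subset _ _))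
  have hconst : ∀ g ∈ E, #(φ g) = #(φ g₀) := by
    intro g hg
    simp only [hE, mem_filter, mem_univ, true_and, Collides, sum_blockLabel] at hg hg₀
    have hfst : ∀ x, (g x).1 = (g₀ x).1 := fun x => by
      have h₁ := congrFun hg.2 x
      have h₂ := congrFun hg₀.2 x
      simp only [Function.comp] at h₁ h₂
      rw [h₁, h₂]
    have h₁ := hg.1
    have h₂ := hg₀.1
    simp only [hfst] at h₁
    have h₃ := card_filter_add_card_filter_not (s := q.2) (fun x => (g x).2 = true)
    have h₄ := card_filter_add_card_filter_not (s := q.2) (fun x => (g₀ x).2 = true)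
    have h₅ : L * (#{x ∈ q.1 | (g x).2} + #{x ∈ q.2 | (g₀ x).2}) =
        L * (#{x ∈ q.1 | (g₀ x).2} + #{x ∈ q.2 | (g x).2}) := by
      rw [mul_add, mul_add]; omega
    have h₆ := Nat.eq_of_mul_eq_mul_left hL h₅
    rw [hφcard, hφcard]
    omega
  have hle : #E ≤ (#D).choose #(φ g₀) * 2 ^ (Fintype.card V - #D) := by
    rw [← card_powersetCard, ← card_compl, ← card_powerset, ← card_product]
    refine card_le_card_of_injOn (fun g => (φ g, {x ∈ Dᶜ | (g x).2})) ?_ ?_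
    · intro g hg
      simp only [coe_product, Set.mem_prod, mem_coe, mem_powersetCard, mem_powerset]
      exact ⟨⟨union_subset_union (filter_subset _ _) (filter_subset _ _), hconst g hg⟩,
        filter_subset _ _⟩
    · intro g hg g' hg' h
      simp only [Prod.mk.injEq] at h
      funext x
      have hfst : (g x).1 = (g' x).1 := by
        have h₁ := congrFun (mem_filter.1 hg).2.2 x
        have h₂ := congrFun (mem_filter.1 hg').2.2 x
        simp only [Function.comp] at h₁ h₂
        rw [h₁, h₂]
      refine Prod.ext hfst ?_
      have h₁ := Finset.ext_iff.1 h.1 x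
      have h₂ := Finset.ext_iff.1 h.2 x
      have h₃ : x ∈ q.1 → x ∉ q.2 := fun h => Finset.disjoint_left.1 hq h
      simp only [φ, D, mem_union, mem_filter, mem_compl] at h₁ h₂
      rw [Bool.eq_iff_iff]
      tauto
  have hD : #D ≤ Fintype.card V := card_le_univ D
  calc #D * #E ^ 2 ≤ #D * ((#D).choose #(φ g₀) * 2 ^ (Fintype.card V - #D)) ^ 2 := by gcongr
    _ = #D * (#D).choose #(φ g₀) ^ 2 * 4 ^ (Fintype.card V - #D) := by
      rw [show (4 : ℕ) = 2 ^ 2 by norm_num, ← pow_mul, mul_pow, ← pow_mul]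
      ring
    _ ≤ 4 ^ #D * 4 ^ (Fintype.card V - #D) := by
      gcongr
      exact mul_choose_sq_le _ _
    _ = 4 ^ Fintype.card V := by rw [← pow_add, Nat.add_sub_cancel' hD]

open Classical in
/-- A constraint with a large support is violated with probability `O(1 / (L * √K))`. -/
lemma card_collides_blockLabel_le {L K : ℕ} (hL : 0 < L) (hK : 0 < K) {q : Finset V × Finset V}
    (hq : Disjoint q.1 q.2) (hqK : K ≤ #(q.1 ∪ q.2)) :
    (#{g : V → Fin L × Bool | Collides (blockLabel L) q g} : ℝ) ≤
      Fintype.card (V → Fin L × Bool) / (L * √K) := by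
  set E : Finset (V → Fin L × Bool) := {g | Collides (blockLabel L) q g} with hE
  let w : Fin L → ZMod L := fun y => 1 + (y : ℕ)
  have hw : Function.Injective w := by
    intro y y' h
    have h' : ((y : ℕ) : ZMod L) = ((y' : ℕ) : ZMod L) := add_left_cancel h
    rw [ZMod.natCast_eq_natCast_iff, Nat.ModEq, Nat.mod_eq_of_lt y.2, Nat.mod_eq_of_lt y'.2] at h'
    exact Fin.ext h'
  set Y : Finset (V → Fin L) := {y | Collides w q y} with hY
  have hYcard : (#Y : ℝ) * L ≤ L ^ Fintype.card V := by
    have := card_collides_mul_card_le hw hq (card_pos.1 (hK.trans_le hqK))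
    rw [Fintype.card_fun, Fintype.card_fin] at this
    exact_mod_cast this
  have hmaps : ∀ g ∈ E, Prod.fst ∘ g ∈ Y := by
    intro g hg
    simp only [hE, hY, mem_filter, mem_univ, true_and, Collides, sum_blockLabel] at hg ⊢
    have := congrArg (Nat.cast : ℕ → ZMod L) hg
    simpa [w] using this
  have hfib : ∀ y ∈ Y, (#{g ∈ E | Prod.fst ∘ g = y} : ℝ) ≤ 2 ^ Fintype.card V / √K := by
    intro y _
    have h := card_collides_fiber_sq_le hL hq y
    rw [hE, filter_filter]
    set e := #{g : V → Fin L × Bool | Collides (blockLabel L) q g ∧ Prod.fst ∘ g = y}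
    have h' : (K : ℝ) * (e : ℝ) ^ 2 ≤ (2 ^ Fintype.card V) ^ 2 := by
      rw [← pow_mul, mul_comm (Fintype.card V), pow_mul]
      norm_num
      exact_mod_cast (Nat.mul_le_mul_right _ hqK).trans h
    have hK' : (0 : ℝ) < √K := Real.sqrt_pos.2 (by exact_mod_cast hK)
    rw [le_div_iff₀ hK']
    refine le_of_sq_le_sq ?_ (by positivity)
    rw [mul_pow, Real.sq_sqrt (by positivity)]
    linarith
  have hL' : (0 : ℝ) < L := by exact_mod_cast hL
  calc (#E : ℝ) = ∑ y ∈ Y, (#{g ∈ E | Prod.fst ∘ g = y} : ℝ) := by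
        exact_mod_cast card_eq_sum_card_fiberwise hmaps
    _ ≤ #Y * (2 ^ Fintype.card V / √K) := by
        rw [← nsmul_eq_mul]; exact sum_le_card_nsmul _ _ _ hfib
    _ ≤ L ^ Fintype.card V / L * (2 ^ Fintype.card V / √K) := by
        gcongr
        rwa [le_div_iff₀ hL']
    _ = _ := by
        simp only [Fintype.card_fun, Fintype.card_prod, Fintype.card_fin, Fintype.card_bool]
        push_cast
        rw [mul_pow, div_mul_div_comm]

end AntiConcentration

section Main

open Finset

/-- Double counting: few coordinates lie in many small sets. -/
lemma card_heavy_mul_le {V : Type*} [Fintype V] [DecidableEq V] (T : Finset (Finset V × Finset V)) (K N : ℕ)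
    (hT : ∀ q ∈ T, #(q.1 ∪ q.2) ≤ K) :
    #{a : V | N < 2 * #{q ∈ T | a ∈ q.1 ∪ q.2}} * N ≤ 2 * (K * #T) := by
  set H : Finset V := {a | N < 2 * #{q ∈ T | a ∈ q.1 ∪ q.2}} with hH
  calc #H * N ≤ ∑ a ∈ H, 2 * #{q ∈ T | a ∈ q.1 ∪ q.2} := by
        rw [← smul_eq_mul]
        exact card_nsmul_le_sum _ _ _ fun a ha => (mem_filter.1 ha).2.le
    _ ≤ ∑ a, 2 * #{q ∈ T | a ∈ q.1 ∪ q.2} := sum_le_sum_of_subset (subset_univ _)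
    _ = 2 * ∑ q ∈ T, #(q.1 ∪ q.2) := by
        rw [← mul_sum]
        congr 1
        have := sum_card_bipartiteAbove_eq_sum_card_bipartiteBelow
          (s := (univ : Finset V)) (t := T) (fun a q => a ∈ q.1 ∪ q.2)
        simpa only [bipartiteAbove, bipartiteBelow, filter_univ_mem] using this
    _ ≤ 2 * (K * #T) := by
        gcongr
        rw [mul_comm K, ← smul_eq_mul]
        exact sum_le_card_nsmul _ _ _ hT

open Classical in
/-- Any family of at most `2 * L * C` sum-distinguishing constraints can be satisfied by labels in
`[1, 2 * L]`, provided that `L` is large in terms of `C`. -/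
lemma exists_forall_not_collides (C : ℕ) : ∃ L₀ : ℕ, ∀ L : ℕ, L₀ < L →
    ∀ {V : Type} [Fintype V] [DecidableEq V] (T : Finset (Finset V × Finset V)),
      (∀ q ∈ T, Disjoint q.1 q.2 ∧ (q.1 ∪ q.2).Nonempty) → #T ≤ C * (2 * L) →
      ∃ g : V → Fin L × Bool, ∀ q ∈ T, ¬ Collides (blockLabel L) q g := by
  obtain ⟨K₀, hK₀⟩ := exists_nat_gt (4 * (C : ℝ) * 4 ^ C)
  set K := K₀ ^ 2 with hKdef
  have hK₀pos : 0 < K₀ := by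
    have : (0 : ℝ) < K₀ := lt_of_le_of_lt (by positivity) hK₀
    exact_mod_cast this
  have hK : 0 < K := by positivity
  have hsqrt : √(K : ℝ) = K₀ := by rw [hKdef]; push_cast; exact Real.sqrt_sq (by positivity)
  refine ⟨4 ^ (2 * (K * C)) * 4 ^ C, fun L hL V _ _ T hT hTcard => ?_⟩
  have hLpos : 0 < L := by omega
  have hL' : (0 : ℝ) < L := by exact_mod_cast hLpos
  have : Nonempty (Fin L × Bool) := ⟨⟨⟨0, hLpos⟩, true⟩⟩
  have hcardα : Fintype.card (Fin L × Bool) = 2 * L := by simp [mul_comm]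
  have hw := blockLabel_injective L
  set S := Fintype.card (V → Fin L × Bool) with hS
  have hSpos : (0 : ℝ) < S := by exact_mod_cast Fintype.card_pos
  set far := {q ∈ T | K ≤ #(q.1 ∪ q.2)} with hfar
  set near := {q ∈ T | ¬ K ≤ #(q.1 ∪ q.2)} with hnear
  set H : Finset V := {a | 2 * L < 2 * #{q ∈ near | a ∈ q.1 ∪ q.2}} with hH
  set light := {q ∈ near | ¬ q.1 ∪ q.2 ⊆ H} with hlight
  set core := {q ∈ near | q.1 ∪ q.2 ⊆ H} with hcore
  have hnearT : near ⊆ T := filter_subset _ _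
  have hlightT : light ⊆ T := (filter_subset _ _).trans hnearT
  have hcoreT : core ⊆ T := (filter_subset _ _).trans hnearT
  have hfarT : far ⊆ T := filter_subset _ _
  have hHcard : #H ≤ 2 * (K * C) := by
    have h := card_heavy_mul_le near K (2 * L) fun q hq => (not_le.1 (mem_filter.1 hq).2).le
    have h' : #H * (2 * L) ≤ 2 * (K * C) * (2 * L) := by
      calc #H * (2 * L) ≤ 2 * (K * #near) := h
        _ ≤ 2 * (K * (C * (2 * L))) := by
          gcongr
          exact (card_le_card hnearT).trans hTcard
        _ = _ := by ring
    exact Nat.le_of_mul_le_mul_right h' (by omega)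
  have hcorecard : #core ≤ 4 ^ (2 * (K * C)) := by
    have hsub : core ⊆ H.powerset ×ˢ H.powerset := by
      intro q hq
      have := (mem_filter.1 hq).2
      rw [mem_product, mem_powerset, mem_powerset]
      exact ⟨subset_union_left.trans this, subset_union_right.trans this⟩
    calc #core ≤ _ := card_le_card hsub
      _ = 4 ^ #H := by rw [card_product, card_powerset, ← mul_pow]; norm_num
      _ ≤ _ := by gcongr; norm_num
  have hgood := le_card_forall_not_collides (α := Fin L × Bool) hw light
    (fun q hq => (hT q (hlightT hq)).1) fun q hq => by
      obtain ⟨a, ha, haH⟩ := not_subset.1 (mem_filter.1 hq).2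
      refine ⟨a, ha, ?_⟩
      rw [hcardα]
      have h : ¬ 2 * L < 2 * #{q ∈ near | a ∈ q.1 ∪ q.2} := fun h =>
        haH (mem_filter.2 ⟨mem_univ _, h⟩)
      have h2 : #{r ∈ light | a ∈ r.1 ∪ r.2} ≤ #{r ∈ near | a ∈ r.1 ∪ r.2} :=
        card_le_card (filter_subset_filter _ (filter_subset _ _))
      omega
  set good : Finset (V → Fin L × Bool) := {g | ∀ q ∈ light, ¬ Collides (blockLabel L) q g}
    with hgooddef
  have hgood' : (S : ℝ) / 4 ^ C ≤ #good := by
    refine le_trans ?_ hgood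
    rw [div_eq_mul_inv, ← Real.rpow_natCast, ← Real.rpow_neg (by norm_num)]
    gcongr
    · norm_num
    · rw [hcardα, neg_div, neg_le_neg_iff, div_le_iff₀ (by positivity)]
      exact_mod_cast (card_le_card hlightT).trans hTcard
  let bad : Finset V × Finset V → Finset (V → Fin L × Bool) := fun q =>
    {g | Collides (blockLabel L) q g}
  have hfarbad : (#(far.biUnion bad) : ℝ) < S / (2 * 4 ^ C) := by
    have h₁ : (#(far.biUnion bad) : ℝ) ≤ #far * (S / (L * √K)) := by
      refine le_trans (Nat.cast_le.2 card_biUnion_le) ?_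
      rw [Nat.cast_sum, ← nsmul_eq_mul]
      exact sum_le_card_nsmul _ _ _ fun q hq =>
        card_collides_blockLabel_le hLpos hK (hT q (hfarT hq)).1 (mem_filter.1 hq).2
    have h₂ : (#far : ℝ) ≤ C * (2 * L) := by
      exact_mod_cast (card_le_card hfarT).trans hTcard
    calc (#(far.biUnion bad) : ℝ) ≤ C * (2 * L) * (S / (L * √K)) := h₁.trans (by gcongr)
      _ = S * (2 * C / K₀) := by rw [hsqrt]; field_simp
      _ < S * (1 / (2 * 4 ^ C)) := by
        refine mul_lt_mul_of_pos_left ?_ hSpos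
        rw [div_lt_div_iff₀ (by exact_mod_cast hK₀pos) (by positivity)]
        linarith
      _ = _ := by ring
  have hcorebad : (#(core.biUnion bad) : ℝ) ≤ S / (2 * 4 ^ C) := by
    have h₁ : (#(core.biUnion bad) : ℝ) ≤ #core * (S / (2 * L)) := by
      refine le_trans (Nat.cast_le.2 card_biUnion_le) ?_
      rw [Nat.cast_sum, ← nsmul_eq_mul]
      refine sum_le_card_nsmul _ _ _ fun q hq => ?_
      have h := card_collides_mul_card_le (α := Fin L × Bool) hw (hT q (hcoreT hq)).1
        (hT q (hcoreT hq)).2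
      rw [hcardα] at h
      rw [le_div_iff₀ (by positivity)]
      exact_mod_cast h
    have h₂ : (#core : ℝ) * 4 ^ C ≤ L := by
      exact_mod_cast (Nat.mul_le_mul_right _ hcorecard).trans hL.le
    calc (#(core.biUnion bad) : ℝ) ≤ #core * (S / (2 * L)) := h₁
      _ = S / (2 * 4 ^ C) * (#core * 4 ^ C / L) := by field_simp
      _ ≤ S / (2 * 4 ^ C) * 1 := by
        gcongr
        rwa [div_le_one hL']
      _ = _ := mul_one _
  have hlt : #(far.biUnion bad ∪ core.biUnion bad) < #good := by
    have h₁ : (#(far.biUnion bad ∪ core.biUnion bad) : ℝ) ≤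
        #(far.biUnion bad) + #(core.biUnion bad) := by exact_mod_cast card_union_le _ _
    have h₂ : (S : ℝ) / (2 * 4 ^ C) + S / (2 * 4 ^ C) = S / 4 ^ C := by field_simp; norm_num
    have h₃ : (#(far.biUnion bad ∪ core.biUnion bad) : ℝ) < #good := by linarith
    exact_mod_cast h₃
  obtain ⟨g, hg, hgbad⟩ := exists_mem_notMem_of_card_lt_card hlt
  refine ⟨g, fun q hq hc => ?_⟩
  have hgb : g ∈ bad q := mem_filter.2 ⟨mem_univ _, hc⟩
  by_cases hqf : K ≤ #(q.1 ∪ q.2)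
  · exact hgbad (mem_union_left _ (mem_biUnion.2 ⟨q, mem_filter.2 ⟨hq, hqf⟩, hgb⟩))
  have hqn : q ∈ near := mem_filter.2 ⟨hq, hqf⟩
  by_cases hqH : q.1 ∪ q.2 ⊆ H
  · exact hgbad (mem_union_right _ (mem_biUnion.2 ⟨q, mem_filter.2 ⟨hqn, hqH⟩, hgb⟩))
  · exact (mem_filter.1 hg).2 q (mem_filter.2 ⟨hqn, hqH⟩) hc

end Main

/-- For every real `C > 0` there exists `n₀` such that for every `n > n₀`, every graph on `n`
vertices admits a vertex sum-distinguishing labeling whose labels are all at most `⌈n²/C⌉`. -/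
theorem stmt4 (C : ℝ) (hC : 0 < C) :
    ∃ n₀ : ℕ, ∀ n : ℕ, n₀ < n → ∀ G : SimpleGraph (Fin n),
      ∃ f : Fin n → ℕ, VertexSumDistinguishing G f ∧ ∀ v, f v ≤ ⌈(n : ℝ) ^ 2 / C⌉₊ := by
  classical
  obtain ⟨C', hC'⟩ := exists_nat_gt (2 * C)
  obtain ⟨L₀, hL₀⟩ := exists_forall_not_collides C'
  obtain ⟨n₀, hn₀⟩ := exists_nat_gt (2 * C * (L₀ + 2))
  refine ⟨n₀, fun n hn G => ?_⟩
  set L := ⌊(n : ℝ) ^ 2 / (2 * C)⌋₊ with hLdef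
  have hn1 : (1 : ℝ) ≤ n := by exact_mod_cast (by omega : 1 ≤ n)
  have hlarge : (L₀ : ℝ) + 2 ≤ (n : ℝ) ^ 2 / (2 * C) := by
    rw [le_div_iff₀ (by positivity)]
    have : (n₀ : ℝ) ≤ n := by exact_mod_cast hn.le
    nlinarith
  have hLgt : (n : ℝ) ^ 2 / (2 * C) < L + 1 := Nat.lt_floor_add_one _
  have hLle : (L : ℝ) ≤ (n : ℝ) ^ 2 / (2 * C) := Nat.floor_le (by positivity)
  have hLL₀ : L₀ + 1 < L + 1 := by
    have : (L₀ : ℝ) + 1 < L + 1 := by linarith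
    exact_mod_cast this
  have hL1 : (1 : ℝ) ≤ L := by exact_mod_cast (by omega : 1 ≤ L)
  let F : Fin n × Fin n → Finset (Fin n) × Finset (Fin n) := fun p =>
    (closedNbr G p.1 \ closedNbr G p.2, closedNbr G p.2 \ closedNbr G p.1)
  let T := (Finset.univ.filter fun p : Fin n × Fin n =>
    closedNbr G p.1 ≠ closedNbr G p.2).image F
  have hT : ∀ q ∈ T, Disjoint q.1 q.2 ∧ (q.1 ∪ q.2).Nonempty := by
    intro q hq
    obtain ⟨p, hp, rfl⟩ := Finset.mem_image.1 hq
    refine ⟨disjoint_sdiff_sdiff, ?_⟩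
    rw [Finset.nonempty_iff_ne_empty]
    intro h
    obtain ⟨h₁, h₂⟩ := Finset.union_eq_empty.1 h
    exact (Finset.mem_filter.1 hp).2 (Finset.Subset.antisymm
      (Finset.sdiff_eq_empty_iff_subset.1 h₁) (Finset.sdiff_eq_empty_iff_subset.1 h₂))
  have hTcard : T.card ≤ C' * (2 * L) := by
    have h₁ : T.card ≤ n ^ 2 := by
      refine Finset.card_image_le.trans ((Finset.card_le_univ _).trans ?_)
      simp [sq]
    have h₂ : (n : ℝ) ^ 2 ≤ C' * (2 * L) := by
      rw [div_lt_iff₀ (by positivity)] at hLgt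
      nlinarith
    exact h₁.trans (by exact_mod_cast h₂)
  obtain ⟨g, hg⟩ := hL₀ L (by omega) T hT hTcard
  refine ⟨fun v => blockLabel L (g v), ⟨fun v => one_le_blockLabel L _, fun u v huv hsum => ?_⟩,
    fun v => ?_⟩
  · refine hg (F (u, v)) (Finset.mem_image_of_mem _ (by simpa using huv)) ?_
    have h₁ := Finset.sum_inter_add_sum_sdiff (closedNbr G u) (closedNbr G v)
      fun x => blockLabel L (g x)
    have h₂ := Finset.sum_inter_add_sum_sdiff (closedNbr G v) (closedNbr G u)
      fun x => blockLabel L (g x)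
    rw [Finset.inter_comm] at h₂
    simp only [Collides, F] at hsum ⊢
    omega
  · refine (blockLabel_le L _).trans ?_
    have : ((2 * L : ℕ) : ℝ) ≤ ⌈(n : ℝ) ^ 2 / C⌉₊ := by
      refine le_trans ?_ (Nat.le_ceil _)
      push_cast
      calc 2 * (L : ℝ) ≤ 2 * ((n : ℝ) ^ 2 / (2 * C)) := by gcongr
        _ = _ := by field_simp
    exact_mod_cast this
end

section
/- For every real ε with 0 < ε < 1 there exists n₀ such that for every integer n > n₀ there exists a hypergraph H on n vertices that admits an irregular edge labeling, and every irregular edge labeling of H uses some label of size at least n^{2−ε}; i.e., irr(H) ≥ n^{2−ε}, hence irr(n) ≥ n^{2−ε}. -/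
/-- An edge labeling of a hypergraph with hyperedge set `E` by positive integers is irregular
if the sums of labels of hyperedges containing a given vertex are distinct for distinct
vertices. -/
def IrregularLabeling {V : Type*} [DecidableEq V] (E : Finset (Finset V))
    (f : Finset V → ℕ) : Prop :=
  (∀ e ∈ E, 1 ≤ f e) ∧ ∀ x y : V, x ≠ y →
    ∑ e ∈ E.filter (fun e => x ∈ e), f e ≠ ∑ e ∈ E.filter (fun e => y ∈ e), f e

/-- The sets of size `n` on which `s` is injective are enumerated by an elementary symmetric
polynomial in the sizes of the fibres of `s`. -/
theorem card_injOn_mul_pow_le {Q : Type*} [Fintype Q] [DecidableEq Q] (s : Q → ℕ) (M n : ℕ)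
    (hs : ∀ q, s q < M) (t : ℝ) (ht : 0 ≤ t)
    [DecidablePred fun W : Finset Q => Set.InjOn s W] :
    (((Finset.powersetCard n (Finset.univ : Finset Q)).filter
      (fun W : Finset Q => Set.InjOn s W)).card : ℝ) * t ^ n ≤
      ∏ v ∈ Finset.range M, (1 + t * ((Finset.univ.filter (fun q => s q = v)).card : ℝ)) := by
  set a : ℕ → Finset Q := fun v => Finset.univ.filter (fun q => s q = v) with ha
  set A := (Finset.powersetCard n (Finset.univ : Finset Q)).filter
      (fun W : Finset Q => Set.InjOn s W) with hA
  have hmaps : Set.MapsTo (fun W : Finset Q => W.image s) A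
      (Finset.powersetCard n (Finset.range M)) := by
    intro W hW
    simp only [hA, Finset.coe_filter, Finset.mem_powersetCard, Set.mem_ofPred_eq] at hW
    simp only [Finset.mem_coe, Finset.mem_powersetCard]
    refine ⟨?_, ?_⟩
    · intro v hv
      obtain ⟨q, -, rfl⟩ := Finset.mem_image.1 hv
      exact Finset.mem_range.2 (hs q)
    · rw [Finset.card_image_of_injOn hW.2, hW.1.2]
  have hfib : ∀ S ∈ Finset.powersetCard n (Finset.range M),
      (A.filter (fun W => W.image s = S)).card ≤ ∏ v ∈ S, (a v).card := by
    intro S _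
    rw [← Finset.card_pi]
    refine le_trans (Finset.card_le_card (t := (S.pi a).image
      (fun p => S.attach.image (fun v => p v.1 v.2))) ?_) Finset.card_image_le
    intro W hW
    simp only [hA, Finset.mem_filter] at hW
    obtain ⟨⟨-, hinj⟩, rfl⟩ := hW
    have hex : ∀ v ∈ W.image s, ∃ w ∈ W, s w = v := fun v hv => Finset.mem_image.1 hv
    choose p hpW hps using hex
    refine Finset.mem_image.2 ⟨p, ?_, ?_⟩
    · simp only [Finset.mem_pi, ha, Finset.mem_filter, Finset.mem_univ, true_and]
      exact hps
    · ext w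
      simp only [Finset.mem_image, Finset.mem_attach, true_and, Subtype.exists]
      constructor
      · rintro ⟨v, ⟨x, hx, rfl⟩, rfl⟩
        exact hpW _ _
      · intro hw
        exact ⟨s w, ⟨w, hw, rfl⟩, hinj (hpW _ _) hw (hps _ _)⟩
  have hcard : A.card ≤ ∑ S ∈ Finset.powersetCard n (Finset.range M), ∏ v ∈ S, (a v).card := by
    rw [Finset.card_eq_sum_card_fiberwise hmaps]
    exact Finset.sum_le_sum hfib
  calc (A.card : ℝ) * t ^ n
      ≤ (∑ S ∈ Finset.powersetCard n (Finset.range M), ∏ v ∈ S, ((a v).card : ℝ)) * t ^ n := by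
        gcongr
        exact_mod_cast hcard
    _ = ∑ S ∈ Finset.powersetCard n (Finset.range M), ∏ v ∈ S, (t * ((a v).card : ℝ)) := by
        rw [Finset.sum_mul]
        refine Finset.sum_congr rfl fun S hS => ?_
        rw [Finset.prod_mul_distrib, Finset.prod_const, (Finset.mem_powersetCard.1 hS).2, mul_comm]
    _ ≤ ∑ S ∈ (Finset.range M).powerset, ∏ v ∈ S, (t * ((a v).card : ℝ)) := by
        refine Finset.sum_le_sum_of_subset_of_nonneg ?_ ?_
        · intro S hS
          exact Finset.mem_powerset.2 (Finset.mem_powersetCard.1 hS).1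
        · intro S _ _
          exact Finset.prod_nonneg fun v _ => by positivity
    _ = ∏ v ∈ Finset.range M, (1 + t * ((a v).card : ℝ)) := by
        rw [Finset.prod_one_add]

theorem one_add_le_exp_sub_sq {u : ℝ} (h0 : 0 ≤ u) (h1 : u ≤ 1) :
    1 + u ≤ Real.exp (u - u ^ 2 / 4) := by
  have hx : 0 ≤ u - u ^ 2 / 4 := by nlinarith
  refine le_trans ?_ (Real.quadratic_le_exp_of_nonneg hx)
  have h : (0 : ℝ) ≤ (1 - u / 4) ^ 2 / 2 - 1 / 4 := by nlinarith
  nlinarith [mul_nonneg (sq_nonneg u) h]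

theorem one_add_le_exp_tangent {u x : ℝ} (h0 : 0 ≤ u) (h1 : u ≤ 1) :
    1 + x ≤ Real.exp (u - u ^ 2 / 4 + (x - u) / (1 + u)) := by
  have hu : 0 < 1 + u := by linarith
  rw [Real.exp_add]
  calc 1 + x = (1 + u) * ((x - u) / (1 + u) + 1) := by field_simp; ring
    _ ≤ (1 + u) * Real.exp ((x - u) / (1 + u)) := by
        gcongr
        exact Real.add_one_le_exp _
    _ ≤ _ := by
        gcongr
        exact one_add_le_exp_sub_sq h0 h1

/-- A quantitative birthday bound for `n`-subsets. -/
theorem card_injOn_le_exp {Q : Type*} [Fintype Q] [DecidableEq Q] (s : Q → ℕ) (M n : ℕ)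
    (hs : ∀ q, s q < M) (hn : 0 < n) (hnM : n ≤ M) (hq : 0 < Fintype.card Q)
    [DecidablePred fun W : Finset Q => Set.InjOn s W] :
    (((Finset.powersetCard n (Finset.univ : Finset Q)).filter
      (fun W : Finset Q => Set.InjOn s W)).card : ℝ) * ((n : ℝ) / Fintype.card Q) ^ n ≤
      Real.exp (n - (n : ℝ) ^ 2 / (4 * M)) := by
  have hn' : (0 : ℝ) < n := by exact_mod_cast hn
  have hM' : (0 : ℝ) < M := by exact_mod_cast hn.trans_le hnM
  have hq' : (0 : ℝ) < Fintype.card Q := by exact_mod_cast hq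
  have hu0 : (0 : ℝ) ≤ n / M := by positivity
  have hu1 : (n : ℝ) / M ≤ 1 := by
    rw [div_le_one hM']
    exact_mod_cast hnM
  have hsum : ∑ v ∈ Finset.range M, ((Finset.univ.filter (fun q : Q => s q = v)).card : ℝ) =
      Fintype.card Q := by
    have := Finset.card_eq_sum_card_fiberwise (f := s) (s := (Finset.univ : Finset Q))
      (t := Finset.range M) (fun q _ => by simpa using hs q)
    rw [Finset.card_univ] at this
    exact_mod_cast this.symm
  refine (card_injOn_mul_pow_le s M n hs _ (by positivity)).trans ?_
  refine (Finset.prod_le_prod (fun v _ => by positivity)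
    (fun v _ => one_add_le_exp_tangent hu0 hu1)).trans ?_
  rw [← Real.exp_sum, Finset.sum_add_distrib, ← Finset.sum_div, Finset.sum_sub_distrib,
    Finset.sum_sub_distrib, ← Finset.mul_sum, hsum]
  simp only [Finset.sum_const, Finset.card_range, nsmul_eq_mul]
  refine le_of_eq (congrArg _ ?_)
  field_simp
  ring

theorem factorial_mul_exp_le (n : ℕ) (hn : 1 ≤ n) :
    (n.factorial : ℝ) * Real.exp n ≤ Real.exp 1 * n * (n : ℝ) ^ n := by
  induction n, hn using Nat.le_induction with
  | base => simp
  | succ n hn ih =>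
    have hn' : (0 : ℝ) < n := by exact_mod_cast hn
    have key : Real.exp 1 * (n : ℝ) ^ (n + 1) ≤ ((n : ℝ) + 1) ^ (n + 1) := by
      have h : (n : ℝ) * Real.exp (1 / ((n : ℝ) + 1)) ≤ n + 1 := by
        have h1 := Real.add_one_le_exp (-(1 / ((n : ℝ) + 1)))
        rw [Real.exp_neg, show -(1 / ((n : ℝ) + 1)) + 1 = n / (n + 1) by field_simp; ring,
          div_le_iff₀ (by positivity), inv_mul_eq_div, le_div_iff₀ (Real.exp_pos _)] at h1
        exact h1
      have h2 := pow_le_pow_left₀ (by positivity) h (n + 1)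
      rw [mul_pow, ← Real.exp_nat_mul] at h2
      have h3 : ((n + 1 : ℕ) : ℝ) * (1 / ((n : ℝ) + 1)) = 1 := by
        push_cast
        field_simp
      rw [h3] at h2
      linarith
    rw [Nat.factorial_succ]
    push_cast
    rw [Real.exp_add]
    calc ((n : ℝ) + 1) * n.factorial * (Real.exp n * Real.exp 1)
        = ((n : ℝ) + 1) * Real.exp 1 * (n.factorial * Real.exp n) := by ring
      _ ≤ ((n : ℝ) + 1) * Real.exp 1 * (Real.exp 1 * n * (n : ℝ) ^ n) := by gcongr
      _ = Real.exp 1 * ((n : ℝ) + 1) * (Real.exp 1 * (n : ℝ) ^ (n + 1)) := by ring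
      _ ≤ _ := by gcongr

theorem pow_mul_exp_le_choose (q n : ℕ) (hn : 1 ≤ n) (hq : 2 * n ^ 2 ≤ q) :
    (q : ℝ) ^ n * Real.exp n ≤ 2 * Real.exp 1 * n * (n : ℝ) ^ n * q.choose n := by
  have hn' : (1 : ℝ) ≤ n := by exact_mod_cast hn
  have hq2 : 2 * (n : ℝ) ^ 2 ≤ q := by exact_mod_cast hq
  have hq' : (0 : ℝ) < q := by nlinarith
  have hnq : n ≤ q := by nlinarith
  have hdesc : ((q : ℝ) - n) ^ n ≤ n.factorial * q.choose n := by
    have h := Nat.pow_sub_le_descFactorial q n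
    rw [Nat.descFactorial_eq_factorial_mul_choose] at h
    have h' : (((q + 1 - n : ℕ) : ℝ)) ^ n ≤ n.factorial * q.choose n := by exact_mod_cast h
    refine le_trans ?_ h'
    have : (n : ℝ) ≤ q := by exact_mod_cast hnq
    rw [Nat.cast_sub (by omega)]
    push_cast
    gcongr
    linarith
  have hbern : (q : ℝ) ^ n / 2 ≤ ((q : ℝ) - n) ^ n := by
    have h := one_add_mul_le_pow (a := -((n : ℝ) / q))
      (by
        have : (n : ℝ) / q ≤ 1 := by rw [div_le_one hq']; exact_mod_cast hnq
        linarith) n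
    have h2 : (n : ℝ) * (n / q) ≤ 1 / 2 := by
      rw [← mul_div_assoc, div_le_iff₀ hq']
      nlinarith
    have h3 : (q : ℝ) - n = q * (1 + -(n / q)) := by field_simp; ring
    rw [h3, mul_pow, div_eq_mul_one_div]
    gcongr
    linarith
  calc (q : ℝ) ^ n * Real.exp n ≤ (2 * (n.factorial * q.choose n)) * Real.exp n := by
        gcongr
        linarith
    _ = 2 * q.choose n * (n.factorial * Real.exp n) := by ring
    _ ≤ 2 * q.choose n * (Real.exp 1 * n * (n : ℝ) ^ n) := by
        exact mul_le_mul_of_nonneg_left (factorial_mul_exp_le n hn) (by positivity)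
    _ = _ := by ring

/-- Some `n` subsets of `Fin m` collide under every weighting of `Fin m` by `0, …, N - 1`. -/
theorem exists_card_eq_forall_not_injOn (n m N : ℕ) (hn : 1 ≤ n) (hm : 1 ≤ m) (hnN : n ≤ m * N)
    (hq : 2 * n ^ 2 ≤ 2 ^ m)
    (h : (N : ℝ) ^ m * (2 * Real.exp 1 * n) < Real.exp ((n : ℝ) ^ 2 / (4 * (m * N : ℕ)))) :
    ∃ W : Finset (Finset (Fin m)), W.card = n ∧ ∀ g : Fin m → Fin N,
      ¬ Set.InjOn (fun T : Finset (Fin m) => ∑ j ∈ T, (g j : ℕ)) W := by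
  classical
  by_contra! hcon
  let B : (Fin m → Fin N) → Finset (Finset (Finset (Fin m))) := fun g =>
    (Finset.powersetCard n Finset.univ).filter
      (fun W => Set.InjOn (fun T : Finset (Fin m) => ∑ j ∈ T, (g j : ℕ)) W)
  have hcover : Finset.powersetCard n (Finset.univ : Finset (Finset (Fin m))) ⊆
      Finset.univ.biUnion B := by
    intro W hW
    obtain ⟨g, hg⟩ := hcon W (Finset.mem_powersetCard.1 hW).2
    exact Finset.mem_biUnion.2 ⟨g, Finset.mem_univ _, Finset.mem_filter.2 ⟨hW, hg⟩⟩
  have hcardQ : Fintype.card (Finset (Fin m)) = 2 ^ m := by simp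
  have hN : 0 < N := by
    rcases Nat.eq_zero_or_pos N with h0 | h0
    · subst h0
      omega
    · exact h0
  have hsum : ∀ (g : Fin m → Fin N) (T : Finset (Fin m)), ∑ j ∈ T, (g j : ℕ) < m * N := by
    intro g T
    calc ∑ j ∈ T, (g j : ℕ) ≤ ∑ j : Fin m, (g j : ℕ) :=
          Finset.sum_le_sum_of_subset (Finset.subset_univ T)
      _ < ∑ _j : Fin m, N :=
          Finset.sum_lt_sum_of_nonempty ⟨⟨0, hm⟩, Finset.mem_univ _⟩ fun j _ => (g j).2
      _ = m * N := by simp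
  set q : ℕ := 2 ^ m with hqdef
  have hn' : (0 : ℝ) < n := by exact_mod_cast hn
  have hq' : (0 : ℝ) < q := by positivity
  set X := Real.exp ((n : ℝ) - (n : ℝ) ^ 2 / (4 * (m * N : ℕ))) with hX
  have hB : ∀ g, ((B g).card : ℝ) * ((n : ℝ) / q) ^ n ≤ X := by
    intro g
    have := card_injOn_le_exp (fun T : Finset (Fin m) => ∑ j ∈ T, (g j : ℕ)) (m * N) n
      (hsum g) hn hnN (by rw [hcardQ]; positivity)
    rw [hcardQ] at this
    exact this
  have hchoose : (q.choose n : ℝ) * ((n : ℝ) / q) ^ n ≤ (N : ℝ) ^ m * X := by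
    have h1 : q.choose n ≤ ∑ g, (B g).card := by
      have := (Finset.card_le_card hcover).trans Finset.card_biUnion_le
      rwa [Finset.card_powersetCard, Finset.card_univ, hcardQ] at this
    calc (q.choose n : ℝ) * ((n : ℝ) / q) ^ n
        ≤ (∑ g, ((B g).card : ℝ)) * ((n : ℝ) / q) ^ n := by
          gcongr
          exact_mod_cast h1
      _ = ∑ g, ((B g).card : ℝ) * ((n : ℝ) / q) ^ n := by rw [Finset.sum_mul]
      _ ≤ ∑ _g : Fin m → Fin N, X := Finset.sum_le_sum fun g _ => hB g
      _ = (N : ℝ) ^ m * X := by simp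
  have hlow := pow_mul_exp_le_choose q n hn hq
  have hfin : Real.exp n ≤ 2 * Real.exp 1 * n * ((N : ℝ) ^ m * X) := by
    rw [div_pow, ← mul_div_assoc, div_le_iff₀ (by positivity)] at hchoose
    have : (q : ℝ) ^ n * Real.exp n ≤ (q : ℝ) ^ n * (2 * Real.exp 1 * n * ((N : ℝ) ^ m * X)) := by
      calc _ ≤ _ := hlow
        _ = 2 * Real.exp 1 * n * (q.choose n * (n : ℝ) ^ n) := by ring
        _ ≤ 2 * Real.exp 1 * n * ((N : ℝ) ^ m * X * (q : ℝ) ^ n) := by gcongr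
        _ = _ := by ring
    exact le_of_mul_le_mul_left this (by positivity)
  have hlt : 2 * Real.exp 1 * n * ((N : ℝ) ^ m * X) < Real.exp n := by
    calc 2 * Real.exp 1 * n * ((N : ℝ) ^ m * X)
        = ((N : ℝ) ^ m * (2 * Real.exp 1 * n)) * X := by ring
      _ < Real.exp ((n : ℝ) ^ 2 / (4 * (m * N : ℕ))) * X := by
          gcongr
      _ = Real.exp n := by
          rw [hX, ← Real.exp_add]
          congr 1
          ring
  exact absurd hfin (not_le.2 hlt)

theorem sum_two_pow_injective {α : Type*} [Fintype α] (φ : α → ℕ)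
    (hφ : Function.Injective φ) (S T : Finset α)
    (h : ∑ e ∈ S, 2 ^ φ e = ∑ e ∈ T, 2 ^ φ e) : S = T := by
  classical
  have hS : ∀ S : Finset α, ∑ e ∈ S, 2 ^ φ e = ∑ i ∈ S.image φ, 2 ^ i := fun S => by
    rw [Finset.sum_image fun x _ y _ hxy => hφ hxy]
  rw [hS, hS] at h
  exact Finset.image_injective hφ (Finset.geomSum_injective le_rfl h)

/-- A family of vectors given by distinct subsets of `Fin m` which collide under every small
weighting yields a hypergraph all of whose irregular labelings use a label at least `N`. -/
theorem exists_hypergraph_of_forall_not_injOn (n m N : ℕ) (W : Finset (Finset (Fin m)))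
    (hW : W.card = n) (hN : 0 < N)
    (hcol : ∀ g : Fin m → Fin N,
      ¬ Set.InjOn (fun T : Finset (Fin m) => ∑ j ∈ T, (g j : ℕ)) W) :
    ∃ E : Finset (Finset (Fin n)),
      (∃ f : Finset (Fin n) → ℕ, IrregularLabeling E f) ∧
      ∀ f : Finset (Fin n) → ℕ, IrregularLabeling E f → ∃ e ∈ E, N ≤ f e := by
  classical
  let eq : Fin n ≃ W := (W.equivFinOfCardEq hW).symm
  let row : Fin n → Finset (Fin m) := fun x => (eq x).1
  have hrow : Function.Injective row := Subtype.val_injective.comp eq.injective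
  let col : Fin m → Finset (Fin n) := fun j => Finset.univ.filter (fun x => j ∈ row x)
  have hmem : ∀ x j, x ∈ col j ↔ j ∈ row x := by simp [col]
  have hEmem : ∀ j, col j ∈ Finset.univ.image col := fun j =>
    Finset.mem_image_of_mem _ (Finset.mem_univ j)
  refine ⟨Finset.univ.image col, ?_, ?_⟩
  · refine ⟨fun e => 2 ^ (Fintype.equivFin (Finset (Fin n)) e : ℕ),
      fun e _ => Nat.one_le_two_pow, fun x y hxy hsum => hxy (hrow ?_)⟩
    have h := sum_two_pow_injective (fun e => (Fintype.equivFin (Finset (Fin n)) e : ℕ))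
      (Fin.val_injective.comp (Equiv.injective _)) _ _ hsum
    ext j
    have hj := Finset.ext_iff.1 h (col j)
    simpa only [Finset.mem_filter, hEmem, true_and, hmem] using hj
  · intro f hf
    by_contra! hlt
    have hex : ∀ e : Finset (Fin n), e ∈ Finset.univ.image col → ∃ j, col j = e := fun e he => by
      simpa using he
    choose r hr using hex
    let g : Fin m → Fin N := fun j =>
      if r (col j) (hEmem j) = j then ⟨f (col j), hlt _ (hEmem j)⟩ else ⟨0, hN⟩
    have hg : ∀ x, ∑ j ∈ row x, (g j : ℕ) =
        ∑ e ∈ (Finset.univ.image col).filter (fun e => x ∈ e), f e := by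
      intro x
      have hgv : ∀ j, (g j : ℕ) = if r (col j) (hEmem j) = j then f (col j) else 0 := by
        intro j
        simp only [g]
        split_ifs <;> rfl
      simp only [hgv]
      rw [← Finset.sum_filter]
      refine Finset.sum_bij' (fun j _ => col j)
        (fun e he => r e (Finset.mem_filter.1 he).1) ?_ ?_ ?_ ?_ ?_
      · intro j hj
        exact Finset.mem_filter.2 ⟨hEmem j, (hmem x j).2 (Finset.mem_filter.1 hj).1⟩
      · intro e he
        have he' := Finset.mem_filter.1 he
        refine Finset.mem_filter.2 ⟨?_, ?_⟩
        · rw [← hmem, hr]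
          exact he'.2
        · simp only [hr]
      · intro j hj
        exact (Finset.mem_filter.1 hj).2
      · intro e he
        exact hr _ _
      · intro j _
        rfl
    refine hcol g fun S hS T hT hST => ?_
    by_contra hne
    have h := hf.2 (eq.symm ⟨S, hS⟩) (eq.symm ⟨T, hT⟩)
      (fun h => hne (by simpa using h))
    rw [← hg, ← hg] at h
    simp only [row, Equiv.apply_symm_apply] at h
    exact h hST

theorem eventually_log_cube_le_rpow (ε : ℝ) (hε : 0 < ε) :
    ∃ n₀ : ℕ, ∀ n : ℕ, n₀ < n → 2 ≤ Real.log n ∧ 521 * Real.log n ^ 3 ≤ (n : ℝ) ^ ε := by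
  have h1 := (isLittleO_log_rpow_rpow_atTop (3 : ℝ) hε).bound
    (show (0 : ℝ) < 1 / 521 by norm_num)
  have h2 := Real.tendsto_log_atTop.eventually_ge_atTop 2
  obtain ⟨n₀, hn₀⟩ := Filter.eventually_atTop.1 (tendsto_natCast_atTop_atTop.eventually (h1.and h2))
  refine ⟨n₀, fun n hn => ?_⟩
  obtain ⟨ha, hb⟩ := hn₀ n hn.le
  refine ⟨hb, ?_⟩
  have hcast : Real.log n ^ (3 : ℝ) = Real.log n ^ 3 := by
    exact_mod_cast Real.rpow_natCast (Real.log n) 3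
  rw [hcast, Real.norm_of_nonneg (by positivity), Real.norm_of_nonneg (by positivity)] at ha
  linarith

/-- For every real `ε` with `0 < ε < 1` there exists `n₀` such that for every `n > n₀` there is
a hypergraph on `n` vertices admitting an irregular edge labeling, and every irregular edge
labeling of it uses some label at least `n^(2−ε)`; i.e. `irr(n) ≥ n^(2−ε)`. -/
theorem stmt12 (ε : ℝ) (hε0 : 0 < ε) (hε1 : ε < 1) :
    ∃ n₀ : ℕ, ∀ n : ℕ, n₀ < n →
      ∃ E : Finset (Finset (Fin n)),
        (∃ f : Finset (Fin n) → ℕ, IrregularLabeling E f) ∧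
        ∀ f : Finset (Fin n) → ℕ, IrregularLabeling E f →
          ∃ e ∈ E, (n : ℝ) ^ (2 - ε) ≤ (f e : ℝ) := by
  obtain ⟨n₀, hn₀⟩ := eventually_log_cube_le_rpow ε hε0
  refine ⟨n₀, fun n hn => ?_⟩
  obtain ⟨hL, hcube⟩ := hn₀ n hn
  set L := Real.log n with hLdef
  have hn1 : 1 ≤ n := by
    rcases Nat.eq_zero_or_pos n with h | h
    · simp [hLdef, h] at hL
      norm_num at hL
    · exact h
  have hnR : (1 : ℝ) ≤ n := by exact_mod_cast hn1
  have hnpos : (0 : ℝ) < n := by linarith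
  have hexpL : Real.exp L = n := Real.exp_log hnpos
  set m := ⌈4 * L⌉₊ with hm
  set N := ⌈(n : ℝ) ^ (2 - ε)⌉₊ with hNdef
  have hm_ge : 4 * L ≤ m := Nat.le_ceil _
  have hm_le : (m : ℝ) ≤ 5 * L := by
    have := (Nat.ceil_lt_add_one (show 0 ≤ 4 * L by linarith)).le
    linarith
  have hm1 : 1 ≤ m := by
    have : (1 : ℝ) ≤ m := by linarith
    exact_mod_cast this
  have hpow1 : (n : ℝ) ≤ (n : ℝ) ^ (2 - ε) := by
    simpa using Real.rpow_le_rpow_of_exponent_le hnR (show (1 : ℝ) ≤ 2 - ε by linarith)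
  have hpow2 : (n : ℝ) ^ (2 - ε) ≤ (n : ℝ) ^ 2 := by
    exact_mod_cast Real.rpow_le_rpow_of_exponent_le hnR (show (2 - ε : ℝ) ≤ 2 by linarith)
  have hN_ge : (n : ℝ) ^ (2 - ε) ≤ N := Nat.le_ceil _
  have hnN : n ≤ N := by exact_mod_cast hpow1.trans hN_ge
  have hN_sq : (N : ℝ) ≤ (n : ℝ) ^ 2 := by
    have : N ≤ n ^ 2 := Nat.ceil_le.2 (by exact_mod_cast hpow2)
    exact_mod_cast this
  have hN_two : (N : ℝ) ≤ 2 * (n : ℝ) ^ (2 - ε) := by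
    have := (Nat.ceil_lt_add_one (show 0 ≤ (n : ℝ) ^ (2 - ε) by positivity)).le
    linarith
  have hNpos : (0 : ℝ) < N := by exact_mod_cast hn1.trans hnN
  have hmpos : (0 : ℝ) < m := by exact_mod_cast hm1
  have hsq : Real.exp (2 * L) = (n : ℝ) ^ 2 := by
    rw [← hexpL, ← Real.exp_nat_mul]
    norm_num
  have htwo : (2 : ℝ) ≤ Real.exp 1 := by
    have := Real.add_one_le_exp 1
    linarith
  have hq : 2 * n ^ 2 ≤ 2 ^ m := by
    have hlog : (0.69 : ℝ) ≤ Real.log 2 := by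
      have := Real.log_two_gt_d9
      linarith
    have : (2 : ℝ) * (n : ℝ) ^ 2 ≤ 2 ^ m := by
      calc (2 : ℝ) * (n : ℝ) ^ 2 ≤ Real.exp 1 * Real.exp (2 * L) := by
            rw [hsq]
            gcongr
        _ = Real.exp (1 + 2 * L) := by rw [Real.exp_add]
        _ ≤ Real.exp (m * Real.log 2) := by
            refine Real.exp_le_exp.2 ?_
            nlinarith
        _ = 2 ^ m := by rw [Real.exp_nat_mul, Real.exp_log two_pos]
    exact_mod_cast this
  have hbound : (N : ℝ) ^ m * (2 * Real.exp 1 * n) <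
      Real.exp ((n : ℝ) ^ 2 / (4 * (m * N : ℕ))) := by
    have hmul : (n : ℝ) ^ (2 - ε) * (n : ℝ) ^ ε = (n : ℝ) ^ 2 := by
      rw [← Real.rpow_add hnpos]
      norm_num
    have hexp : 2 * L * m + 2 + L < (n : ℝ) ^ 2 / (4 * (m * N : ℕ)) := by
      push_cast
      rw [lt_div_iff₀ (by positivity)]
      have hL2 : 2 * L * m + 2 + L ≤ 12 * L ^ 2 := by nlinarith
      have hL3 : (2 * L * m + 2 + L) * (4 * m * 2) ≤ 12 * L ^ 2 * (4 * (5 * L) * 2) := by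
        gcongr
      have hpε : 0 < (n : ℝ) ^ (2 - ε) := by positivity
      have hL0 : 0 < L ^ 3 := by positivity
      calc (2 * L * m + 2 + L) * (4 * (m * N))
          ≤ (2 * L * m + 2 + L) * (4 * (m * (2 * (n : ℝ) ^ (2 - ε)))) := by gcongr
        _ = (2 * L * m + 2 + L) * (4 * m * 2) * (n : ℝ) ^ (2 - ε) := by ring
        _ < (n : ℝ) ^ ε * (n : ℝ) ^ (2 - ε) := by
            gcongr
            linarith
        _ = (n : ℝ) ^ 2 := by rw [mul_comm, hmul]
    calc (N : ℝ) ^ m * (2 * Real.exp 1 * n)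
        ≤ Real.exp (2 * L) ^ m * (Real.exp 1 * Real.exp 1 * Real.exp L) := by
          rw [hsq, hexpL]
          gcongr
      _ = Real.exp (2 * L * m + 2 + L) := by
          rw [← Real.exp_nat_mul, ← Real.exp_add, ← Real.exp_add, ← Real.exp_add]
          congr 1
          ring
      _ < _ := Real.exp_lt_exp.2 hexp
  obtain ⟨W, hW, hcol⟩ := exists_card_eq_forall_not_injOn n m N hn1 hm1
    (hnN.trans (Nat.le_mul_of_pos_left N hm1)) hq hbound
  obtain ⟨E, hE, hall⟩ :=
    exists_hypergraph_of_forall_not_injOn n m N W hW (hn1.trans hnN) hcol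
  refine ⟨E, hE, fun f hf => ?_⟩
  obtain ⟨e, he, hle⟩ := hall f hf
  exact ⟨e, he, hN_ge.trans (by exact_mod_cast hle)⟩
end
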